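/- Let n ≥ 1, let A and B be nonnegative n×n real matrices with graph(A) a subgraph of graph(B), and let (x*, y*) be a Nash equilibrium of the SRUC game (A, B). Then support(y*) is predecessor-inclusive in graph(A): for every pair (u, v) with u ≠ v and A_{u,v} > 0, if y*_v > 0 then y*_u > 0. -/

import Mathlib

open Finset

/-- Inner product `xᵀy`. -/
noncomputable def dotp {n : ℕ} (x y : Fin n → ℝ) : ℝ := ∑ i, x i * y i

/-- Bilinear form `xᵀCy`. -/
noncomputable def quadForm {n : ℕ} (C : Matrix (Fin n) (Fin n) ℝ) (x y : Fin n → ℝ) : ℝ :=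
  ∑ i, ∑ j, x i * C i j * y j

/-- The SRUC payoff `e^C(x,y) ∈ [0,∞]`. -/
noncomputable def payoff {n : ℕ} (C : Matrix (Fin n) (Fin n) ℝ) (x y : Fin n → ℝ) : ENNReal :=
  if 0 < dotp x y then ENNReal.ofReal (quadForm C x y / dotp x y)
  else if 0 < quadForm C x y then ⊤ else 0

/-- The standard simplex `Δ_n`. -/
def simplex (n : ℕ) : Set (Fin n → ℝ) := {x | (∀ i, 0 ≤ x i) ∧ ∑ i, x i = 1}

/-- Nash equilibrium of the SRUC game `(A, B)`. -/
def IsNash {n : ℕ} (A B : Matrix (Fin n) (Fin n) ℝ) (xs ys : Fin n → ℝ) : Prop :=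
  xs ∈ simplex n ∧ ys ∈ simplex n ∧
  (∀ x ∈ simplex n, payoff A x ys ≤ payoff A xs ys) ∧
  (∀ y ∈ simplex n, payoff B xs ys ≤ payoff B xs y)

/-- `C` is irreducible: `graph(C)` (edges `(i,j)` with `i ≠ j`, `C i j > 0`) is
strongly connected. -/
def MatIrreducible {n : ℕ} (C : Matrix (Fin n) (Fin n) ℝ) : Prop :=
  ∀ i j : Fin n, Relation.ReflTransGen (fun a b => a ≠ b ∧ 0 < C a b) i j

section

variable {n : ℕ}

theorem single_one_mem_simplex (u : Fin n) : Pi.single u (1 : ℝ) ∈ simplex n := by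
  refine ⟨fun i => ?_, by simp⟩
  by_cases h : i = u
  · subst h; simp
  · simp [h]

theorem payoff_eq_top_iff {C : Matrix (Fin n) (Fin n) ℝ} {x y : Fin n → ℝ} :
    payoff C x y = ⊤ ↔ dotp x y ≤ 0 ∧ 0 < quadForm C x y := by
  unfold payoff
  split_ifs with h₁ h₂
  · simp [h₁]
  · simpa using ⟨not_lt.mp h₁, h₂⟩
  · simp [h₂]

theorem quadForm_pos_iff {C : Matrix (Fin n) (Fin n) ℝ} {x y : Fin n → ℝ}
    (hC : ∀ i j, 0 ≤ C i j) (hx : ∀ i, 0 ≤ x i) (hy : ∀ i, 0 ≤ y i) :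
    0 < quadForm C x y ↔ ∃ i j, 0 < x i ∧ 0 < C i j ∧ 0 < y j := by
  have hterm : ∀ i j, 0 ≤ x i * C i j * y j := fun i j =>
    mul_nonneg (mul_nonneg (hx i) (hC i j)) (hy j)
  unfold quadForm
  rw [Finset.sum_pos_iff_of_nonneg fun i _ => Finset.sum_nonneg fun j _ => hterm i j]
  simp only [Finset.mem_univ, true_and]
  refine exists_congr fun i => ?_
  rw [Finset.sum_pos_iff_of_nonneg fun j _ => hterm i j]
  simp only [Finset.mem_univ, true_and]
  refine exists_congr fun j => ⟨fun h => ⟨?_, ?_, ?_⟩, fun ⟨h₁, h₂, h₃⟩ => by positivity⟩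
  · exact (hx i).lt_of_ne fun h0 => by simp [← h0] at h
  · exact (hC i j).lt_of_ne fun h0 => by simp [← h0] at h
  · exact (hy j).lt_of_ne fun h0 => by simp [← h0] at h

theorem dotp_pos {x y : Fin n → ℝ} (hx : ∀ i, 0 ≤ x i) (hy : ∀ i, 0 ≤ y i) {i : Fin n}
    (hxi : 0 < x i) (hyi : 0 < y i) : 0 < dotp x y :=
  Finset.sum_pos' (fun j _ => mul_nonneg (hx j) (hy j))
    ⟨i, Finset.mem_univ i, mul_pos hxi hyi⟩

/-- An infinite payoff passes to any matrix whose graph is larger. -/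
theorem payoff_eq_top_of_subgraph {A B : Matrix (Fin n) (Fin n) ℝ} {x y : Fin n → ℝ}
    (hA : ∀ i j, 0 ≤ A i j) (hB : ∀ i j, 0 ≤ B i j)
    (hsub : ∀ i j : Fin n, i ≠ j → 0 < A i j → 0 < B i j)
    (hx : ∀ i, 0 ≤ x i) (hy : ∀ i, 0 ≤ y i) (h : payoff A x y = ⊤) : payoff B x y = ⊤ := by
  rw [payoff_eq_top_iff, quadForm_pos_iff hA hx hy] at h
  rw [payoff_eq_top_iff, quadForm_pos_iff hB hx hy]
  obtain ⟨hdot, i, j, hxi, hAij, hyj⟩ := h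
  refine ⟨hdot, i, j, hxi, hsub i j ?_ hAij, hyj⟩
  rintro rfl
  exact (dotp_pos hx hy hxi hyj).not_ge hdot

/-- The minimizing player can always hold the payoff finite by copying the opponent. -/
theorem payoff_self_ne_top (C : Matrix (Fin n) (Fin n) ℝ) {x : Fin n → ℝ}
    (hx : x ∈ simplex n) : payoff C x x ≠ ⊤ := by
  obtain ⟨hx₀, hx₁⟩ := hx
  obtain ⟨i, -, hi⟩ := (Finset.sum_pos_iff_of_nonneg fun i _ => hx₀ i).mp
    (hx₁ ▸ one_pos : 0 < ∑ i, x i)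
  exact fun h => (dotp_pos hx₀ hx₀ hi hi).not_ge (payoff_eq_top_iff.mp h).1

end

theorem stmt19 (n : ℕ) (hn : 1 ≤ n) (A B : Matrix (Fin n) (Fin n) ℝ)
    (hA : ∀ i j, 0 ≤ A i j) (hB : ∀ i j, 0 ≤ B i j)
    (hsub : ∀ i j : Fin n, i ≠ j → 0 < A i j → 0 < B i j)
    (xs ys : Fin n → ℝ) (hne : IsNash A B xs ys) :
    ∀ u v : Fin n, u ≠ v → 0 < A u v → 0 < ys v → 0 < ys u := by
  intro u v _ hAuv hyv
  obtain ⟨hxs, hys, hmax, hmin⟩ := hne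
  by_contra hyu
  have hyu₀ : ys u = 0 := le_antisymm (not_lt.mp hyu) (hys.1 u)
  have hsingle := single_one_mem_simplex u
  have hdev : payoff A (Pi.single u 1) ys = ⊤ := by
    rw [payoff_eq_top_iff, quadForm_pos_iff hA hsingle.1 hys.1]
    exact ⟨by simp [dotp, Pi.single_apply, hyu₀], u, v, by simp, hAuv, hyv⟩
  have hAtop : payoff A xs ys = ⊤ := top_le_iff.mp (hdev ▸ hmax _ hsingle)
  have hBtop := payoff_eq_top_of_subgraph hA hB hsub hxs.1 hys.1 hAtop
  exact payoff_self_ne_top B hxs (top_le_iff.mp (hBtop ▸ hmin xs hxs))
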